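/- For every integer d ≥ 1, the arithmetic complexes C_•(x, 1^d) and C_•(-x-2d, 1^d) over the ring of integer-valued polynomials R are isomorphic as chain complexes of R-modules, via the chain map α_• whose component α_{d-t+1} sends f_{(λ_t,…,λ_1)} to ∑_{μ_1+⋯+μ_t=d-t+1} (-1)^{d-μ_t} ∏_{s=0}^{t-2} binom(∑_{j=1}^{s}(λ_j+μ_j)+μ_{s+1}+2s, ∑_{j=1}^{s}(λ_j+μ_j)+λ_{s+1}+2s) f_{(μ_t,…,μ_1)}; each α_{d-t+1} is invertible (upper triangular with diagonal entries ±1 in a suitable basis order). -/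

import Mathlib

open Finset

/-- Generalized binomial coefficient `binom(a, b)` for integers `a, b`:
`a(a-1)⋯(a-b+1)/b!` when `b ≥ 0`, and `0` when `b < 0`. -/
noncomputable def zbinom (a b : ℤ) : ℤ := if 0 ≤ b then Ring.choose a b.toNat else 0

/-- `S(s) = ∑_{m=1}^{s} (μ_m + λ_m)`. -/
def Sfun (lam mu : ℕ → ℕ) (s : ℕ) : ℤ := ∑ m ∈ Finset.Icc 1 s, ((mu m : ℤ) + (lam m : ℤ))

/-- `A_k(λ,μ) = ∏_{s=0}^{k-2} binom(S(s)+μ_{s+1}+2s, S(s)+λ_{s+1}+2s)`. -/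
noncomputable def Afun (lam mu : ℕ → ℕ) (k : ℕ) : ℤ :=
  ∏ s ∈ Finset.range (k - 1),
    zbinom (Sfun lam mu s + (mu (s+1) : ℤ) + 2 * s) (Sfun lam mu s + (lam (s+1) : ℤ) + 2 * s)

/-- `B_k(λ,μ) = ∏_{s=k+1}^{t-1} binom(S(s-1)+μ_s+μ_{s+1}+2s-1, S(s)+2s-1)`. -/
noncomputable def Bfun (t : ℕ) (lam mu : ℕ → ℕ) (k : ℕ) : ℤ :=
  ∏ s ∈ Finset.Icc (k + 1) (t - 1),
    zbinom (Sfun lam mu (s - 1) + (mu s : ℤ) + (mu (s+1) : ℤ) + 2 * s - 1)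
      (Sfun lam mu s + 2 * s - 1)

/-- `g_k(λ,μ;z) = binom(S(k-1)+μ_k+2(k-1), S(k-1)+λ_k-z+2(k-1))`. -/
noncomputable def gfun (lam mu : ℕ → ℕ) (k : ℕ) (z : ℤ) : ℤ :=
  zbinom (Sfun lam mu (k - 1) + (mu k : ℤ) + 2 * ((k : ℤ) - 1))
    (Sfun lam mu (k - 1) + (lam k : ℤ) - z + 2 * ((k : ℤ) - 1))

/-- `h_k(λ,μ;z) = binom(S(k)+μ_{k+1}-z+2(k-1)+2, S(k)+2(k-1)+1)`. -/
noncomputable def hfun (lam mu : ℕ → ℕ) (k : ℕ) (z : ℤ) : ℤ :=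
  zbinom (Sfun lam mu k + (mu (k+1) : ℤ) - z + 2 * ((k : ℤ) - 1) + 2)
    (Sfun lam mu k + 2 * ((k : ℤ) - 1) + 1)

/-- Reindexing of a tuple `f : Fin n → ℕ` (with `f ⟨m-1⟩` giving the part with subscript
`m`) as a function `ℕ → ℕ` supported on `{1, …, n}`. -/
def toFun (n : ℕ) (f : Fin n → ℕ) : ℕ → ℕ :=
  fun m => if h : 1 ≤ m ∧ m ≤ n then f ⟨m - 1, by omega⟩ else 0

/-- The weak composition `(λ_t, …, λ_{j+1}, i-1, λ_j - i, λ_{j-1}, …, λ_1)` (with `t+1`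
parts, subscripts `1, …, t+1`) obtained from `λ = (λ_t, …, λ_1)` by splitting the `j`-th
interval at its `i`-th edge. -/
def split (lam : ℕ → ℕ) (j i : ℕ) : ℕ → ℕ := fun m =>
  if m < j then lam m else if m = j then lam j - i else if m = j + 1 then i - 1 else lam (m - 1)

/-- The coefficient of `f_ν` in `∂(f_λ)`, for the arithmetic complex `C_•(w_0, 1^d)` with
`w_0 = x`: the differential is
`∂(f_{(λ_t,…,λ_1)}) = ∑_{j=1}^{t} ∑_{i=1}^{λ_j} (-1)^{t-j} binom(ω(I_{λ_j}), ω(I_{λ_j}∖{i}))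
f_{(λ_t,…,λ_{j+1},i-1,λ_j-i,λ_{j-1},…,λ_1)}`,
where `λ` has `t` parts, `ω(I_{λ_j}) = λ_j + 1` for `j < t` and `x + λ_t` for `j = t`
(the leftmost interval contains the vertex of weight `w_0 = x`), and
`ω(I_{λ_j}∖{i}) = λ_j - i + 1`. -/
noncomputable def Dmat (x : ℤ) (t : ℕ) (nu lam : ℕ → ℕ) : ℤ :=
  ∑ j ∈ Finset.Icc 1 t, ∑ i ∈ Finset.Icc 1 (lam j),
    if ∀ m ∈ Finset.Icc 1 (t + 1), nu m = split lam j i m then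
      (-1 : ℤ) ^ (t - j) *
        (if j = t then zbinom (x + (lam t : ℤ)) ((lam t : ℤ) - i + 1)
          else zbinom ((lam j : ℤ) + 1) ((lam j : ℤ) - i + 1))
    else 0

/-- The coefficient of `f_μ` in `α(f_λ)`, for weak compositions `λ, μ` with `t` parts:
`(-1)^{d-μ_t} ∏_{s=0}^{t-2} binom(∑_{j≤s}(λ_j+μ_j)+μ_{s+1}+2s, ∑_{j≤s}(λ_j+μ_j)+λ_{s+1}+2s)`. -/
noncomputable def Amat (d t : ℕ) (lam mu : ℕ → ℕ) : ℤ :=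
  (-1 : ℤ) ^ (d - mu t) * Afun lam mu t

section Binomial

lemma zbinom_natCast (a b : ℕ) : zbinom (a : ℤ) (b : ℤ) = (a.choose b : ℤ) := by
  simp [zbinom, Ring.choose_natCast]

lemma zbinom_natCast_right (a : ℤ) (b : ℕ) : zbinom a (b : ℤ) = Ring.choose a b := by
  simp [zbinom]

lemma zbinom_of_neg (a : ℤ) {b : ℤ} (hb : b < 0) : zbinom a b = 0 := by
  simp [zbinom, not_le.mpr hb]

lemma zbinom_eq_zero_of_lt {a b : ℤ} (ha : 0 ≤ a) (hab : a < b) : zbinom a b = 0 := by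
  lift a to ℕ using ha
  lift b to ℕ using by omega
  rw [zbinom_natCast, Nat.choose_eq_zero_of_lt (by omega), Nat.cast_zero]

lemma zbinom_self {a : ℤ} (ha : 0 ≤ a) : zbinom a a = 1 := by
  lift a to ℕ using ha
  simp [zbinom_natCast]

lemma zbinom_symm {a : ℤ} (ha : 0 ≤ a) (b : ℤ) : zbinom a b = zbinom a (a - b) := by
  rcases lt_or_ge b 0 with hb | hb
  · rw [zbinom_of_neg a hb, zbinom_eq_zero_of_lt ha (by omega)]
  rcases lt_or_ge a b with hab | hab
  · rw [zbinom_eq_zero_of_lt ha hab, zbinom_of_neg a (by omega)]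
  lift a to ℕ using ha
  lift b to ℕ using hb
  have h : b ≤ a := by omega
  rw [← Nat.cast_sub h, zbinom_natCast, zbinom_natCast, Nat.choose_symm h]

/-- A Saalschütz-type convolution of three binomial coefficients. -/
lemma sum_choose_mul_choose_mul_choose (m n q r s u : ℕ) (hu : u + s = n + r)
    (hq : q + r = m + s) :
    ∑ k ∈ range (n + 1), q.choose k * u.choose (n - k) * (r + k).choose (m + n) =
      r.choose m * s.choose n := by
  have expand : ∀ k ∈ range (n + 1), q.choose k * u.choose (n - k) * (r + k).choose (m + n) =
      ∑ j ∈ range (n + 1),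
        r.choose (m + n - j) * (q.choose k * k.choose j * u.choose (n - k)) := by
    intro k hk
    rw [mem_range] at hk
    rw [add_comm r k, Nat.add_choose_eq, Nat.sum_antidiagonal_eq_sum_range_succ_mk,
      ← Finset.sum_subset (s₁ := range (n + 1)), mul_sum]
    · exact sum_congr rfl fun j _ => by ring
    · intro j; simp only [mem_range]; omega
    · intro j _ hj
      simp only [mem_range] at hj
      rw [Nat.choose_eq_zero_of_lt (by omega), zero_mul]
  have inner : ∀ j ∈ range (n + 1),
      ∑ k ∈ range (n + 1), r.choose (m + n - j) * (q.choose k * k.choose j * u.choose (n - k)) =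
        r.choose m * (q.choose j * (r - m).choose (n - j)) := by
    intro j hj
    rw [mem_range] at hj
    rcases lt_or_ge q j with hqj | hqj
    · rw [Nat.choose_eq_zero_of_lt hqj, zero_mul, mul_zero]
      refine sum_eq_zero fun k _ => ?_
      rcases lt_or_ge q k with h | h
      · rw [Nat.choose_eq_zero_of_lt h]; simp
      · rw [Nat.choose_eq_zero_of_lt (show k < j by omega)]; simp
    rw [← mul_sum]
    have : ∑ k ∈ range (n + 1), q.choose k * k.choose j * u.choose (n - k) =
        q.choose j * (m + n - j).choose (n - j) := by
      rw [show n + 1 = j + (n - j + 1) by omega, sum_range_add, sum_eq_zero, zero_add,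
        show m + n - j = (q - j) + u by omega, Nat.add_choose_eq,
        Nat.sum_antidiagonal_eq_sum_range_succ_mk, mul_sum]
      · refine sum_congr rfl fun k hk => ?_
        rw [Nat.choose_mul (Nat.le_add_right j k), Nat.add_sub_cancel_left,
          show n - (j + k) = n - j - k by omega, mul_assoc]
      · intro k hk
        rw [mem_range] at hk
        rw [Nat.choose_eq_zero_of_lt hk]; simp
    rw [this]
    rcases lt_or_ge r m with hrm | hrm
    · rw [Nat.choose_eq_zero_of_lt hrm, Nat.choose_eq_zero_of_lt (show r < m + n - j by omega)]
      simp
    · have h₁ := Nat.choose_mul (n := r) (k := m + n - j) (s := m) (by omega)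
      have h₂ : (m + n - j).choose (n - j) = (m + n - j).choose m :=
        Nat.choose_symm_of_eq_add (by omega)
      rw [show m + n - j - m = n - j by omega] at h₁
      rw [h₂, mul_left_comm, h₁]
      ring
  rw [sum_congr rfl expand, sum_comm, sum_congr rfl inner, ← mul_sum]
  rcases lt_or_ge r m with hrm | hrm
  · simp [Nat.choose_eq_zero_of_lt hrm]
  · rw [show s = q + (r - m) by omega, Nat.add_choose_eq,
      Nat.sum_antidiagonal_eq_sum_range_succ_mk]

lemma sum_zbinom_mul_zbinom_mul_zbinom (p a b l : ℕ) :
    ∑ k ∈ range (l + 2), zbinom ((l : ℤ) + 1) k * zbinom ((p : ℤ) + a) ((p : ℤ) + k - 1) *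
        zbinom ((p : ℤ) + a + b + 1 + k) ((p : ℤ) + l + a + 1) =
      zbinom ((a : ℤ) + b + 2) ((a : ℤ) + 1) * zbinom ((p : ℤ) + a + b + 1) ((p : ℤ) + l) := by
  let f : ℕ → ℤ := fun k => ((l + 1).choose k : ℤ) *
    zbinom ((p : ℤ) + a) ((a : ℤ) + 1 - k) * ((p + a + b + 1 + k).choose (p + l + (a + 1)) : ℤ)
  have h₁ : ∀ k : ℕ, zbinom ((l : ℤ) + 1) k * zbinom ((p : ℤ) + a) ((p : ℤ) + k - 1) *
      zbinom ((p : ℤ) + a + b + 1 + k) ((p : ℤ) + l + a + 1) = f k := by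
    intro k
    simp only [f]
    rw [zbinom_symm (b := (p : ℤ) + k - 1) (by positivity), ← zbinom_natCast, ← zbinom_natCast]
    push_cast
    rw [show (p : ℤ) + a - (p + k - 1) = a + 1 - k by ring,
      show (p : ℤ) + l + (a + 1) = p + l + a + 1 by ring]
  have h₂ : ∀ k ∈ range (a + 2), f k = (((l + 1).choose k * (p + a).choose (a + 1 - k) *
      (p + a + b + 1 + k).choose (p + l + (a + 1)) : ℕ) : ℤ) := by
    intro k hk
    rw [mem_range] at hk
    simp only [f]
    push_cast
    congr 2
    rw [← zbinom_natCast, Nat.cast_sub (by omega)]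
    push_cast
    rfl
  have h₃ : ∑ k ∈ range (l + 2), f k = ∑ k ∈ range (a + 2), f k := by
    have key : ∀ n, l + 2 ≤ n ∨ a + 2 ≤ n → f n = 0 := by
      rintro n (h | h)
      · simp only [f]
        rw [Nat.choose_eq_zero_of_lt (by omega)]; simp
      · simp only [f]
        rw [zbinom_of_neg _ (by omega)]; simp
    rcases le_total l a with h | h
    · refine sum_subset (by intro; simp only [mem_range]; omega) fun k _ hk => key k ?_
      simp only [mem_range] at hk; omega
    · refine (sum_subset (by intro; simp only [mem_range]; omega) fun k _ hk => key k ?_).symm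
      simp only [mem_range] at hk; omega
  rw [sum_congr rfl fun k _ => h₁ k, h₃, sum_congr rfl h₂, ← Nat.cast_sum,
    sum_choose_mul_choose_mul_choose (p + l) (a + 1) (l + 1) (p + a + b + 1) (a + b + 2) (p + a)
      (by omega) (by omega)]
  push_cast
  rw [← zbinom_natCast, ← zbinom_natCast, mul_comm]
  push_cast
  rfl

lemma sum_Icc_one_eq_sum_range_sub (n : ℕ) (f : ℕ → ℤ) :
    ∑ i ∈ Icc 1 n, f i = ∑ k ∈ range n, f (n - k) := by
  refine sum_nbij' (fun i => n - i) (fun k => n - k) ?_ ?_ ?_ ?_ ?_ <;> intro i hi <;>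
    simp only [mem_Icc, mem_range] at hi ⊢ <;> try omega
  congr 1; omega

lemma sum_Icc_one_eq_sum_range_succ (n : ℕ) (f : ℕ → ℤ) :
    ∑ i ∈ Icc 1 n, f i = ∑ k ∈ range n, f (k + 1) := by
  refine sum_nbij' (fun i => i - 1) (fun k => k + 1) ?_ ?_ ?_ ?_ ?_ <;> intro i hi <;>
    simp only [mem_Icc, mem_range] at hi ⊢ <;> try omega
  congr 1; omega

/-- The interior part of the three-binomial convolution, with its two end terms split off. -/
lemma sum_Icc_zbinom_mul_zbinom_mul_zbinom (p a b l : ℕ) :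
    ∑ i ∈ Icc 1 l, zbinom ((l : ℤ) + 1) ((l : ℤ) - i + 1) *
        zbinom ((p : ℤ) + a) ((p : ℤ) + l - i) *
        zbinom ((p : ℤ) + a + b + l - i + 2) ((p : ℤ) + l + a + 1) +
      (zbinom ((p : ℤ) + a) ((a : ℤ) + 1) *
          zbinom ((p : ℤ) + a + b + 1) ((p : ℤ) + a + l + 1) +
        zbinom ((p : ℤ) + a) ((p : ℤ) + l) *
          zbinom ((p : ℤ) + l + a + b + 2) ((b : ℤ) + 1)) =
      zbinom ((a : ℤ) + b + 2) ((a : ℤ) + 1) * zbinom ((p : ℤ) + a + b + 1) ((p : ℤ) + l) := by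
  have split_ends : ∀ F : ℕ → ℤ, ∑ k ∈ range (l + 2), F k =
      ∑ k ∈ range l, F (k + 1) + (F 0 + F (l + 1)) := fun F => by
    rw [sum_range_succ, sum_range_succ', add_assoc]
  rw [← sum_zbinom_mul_zbinom_mul_zbinom, split_ends, sum_Icc_one_eq_sum_range_sub]
  congr 1
  · refine sum_congr rfl fun k hk => ?_
    rw [mem_range] at hk
    rw [Nat.cast_sub hk.le]
    push_cast
    congr 2
    · congr 1; ring
    · congr 1; ring
    · ring
  · have e₀ : zbinom ((l : ℤ) + 1) ((0 : ℕ) : ℤ) = 1 := by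
      simp [zbinom]
    have e₁ : zbinom ((l : ℤ) + 1) ((l + 1 : ℕ) : ℤ) = 1 := by
      push_cast; exact zbinom_self (by positivity)
    rw [e₀, e₁, zbinom_symm (b := (a : ℤ) + 1) (by positivity),
      zbinom_symm (b := (b : ℤ) + 1) (by positivity)]
    push_cast
    ring_nf

/-- Vandermonde convolution with an arbitrary integer upper index. -/
lemma sum_Icc_zbinom_mul_zbinom (y : ℤ) (p a l : ℕ) (hal : a + 1 ≤ l) :
    ∑ i ∈ Icc 1 l, zbinom y ((l : ℤ) - i + 1) * zbinom ((p : ℤ) + a) ((p : ℤ) + l - i) +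
        zbinom ((p : ℤ) + a) ((a : ℤ) + 1) =
      zbinom (y + p + a) ((a : ℤ) + 1) := by
  have h : zbinom (y + p + a) ((a : ℤ) + 1) = ∑ k ∈ range (a + 2),
      zbinom y k * zbinom ((p : ℤ) + a) ((a : ℤ) + 1 - k) := by
    rw [show ((a : ℤ) + 1) = ((a + 1 : ℕ) : ℤ) by push_cast; rfl, zbinom_natCast_right, add_assoc,
      Ring.add_choose_eq _ (Commute.all _ _), Nat.sum_antidiagonal_eq_sum_range_succ_mk]
    refine sum_congr rfl fun k hk => ?_
    rw [mem_range] at hk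
    rw [← Nat.cast_sub (by omega), zbinom_natCast_right, zbinom_natCast_right]
  rw [h, sum_range_succ', sum_Icc_one_eq_sum_range_sub]
  congr 1
  · refine Eq.trans ?_ (sum_subset (s₁ := range (a + 1)) (s₂ := range l)
      (f := fun k : ℕ => zbinom y ((l : ℤ) - (l - k : ℕ) + 1) *
        zbinom ((p : ℤ) + a) ((p : ℤ) + l - (l - k : ℕ))) ?_ ?_).symm |>.trans ?_
    · rfl
    · intro; simp only [mem_range]; omega
    · intro k hk hk'
      simp only [mem_range] at hk hk'
      rw [zbinom_eq_zero_of_lt (a := (p : ℤ) + a) (by positivity) (by omega), mul_zero]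
    · refine sum_congr rfl fun k hk => ?_
      rw [mem_range] at hk
      rw [Nat.cast_sub (show k ≤ l by omega), zbinom_symm (b := (a : ℤ) + 1 - _) (by positivity)]
      push_cast
      ring_nf
  · simp [zbinom]

lemma zbinom_neg (y : ℤ) (b : ℕ) : zbinom (-y) b = (-1) ^ b * zbinom (y + b - 1) b := by
  rw [zbinom_natCast_right, zbinom_natCast_right, Ring.choose_neg]
  simp [Int.negOnePow_def, Units.smul_def]

end Binomial

section Products

/-- The sequence obtained from `v` by merging the parts with subscripts `j` and `j + 1` into the
single part `v j + v (j + 1) + 1`. -/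
def merge (v : ℕ → ℕ) (j : ℕ) : ℕ → ℕ := fun m =>
  if m < j then v m else if m = j then v j + v (j + 1) + 1 else v (m + 1)

/-- The part of the product `Afun` over indices in `[j, n)` after a split or merge below `j`. -/
noncomputable def tailProd (l v : ℕ → ℕ) (n j : ℕ) : ℤ :=
  ∏ s ∈ Finset.Ico j n, zbinom (Sfun l v s + v (s + 1) + v (s + 2) + 2 * s + 1)
    (Sfun l v s + v (s + 1) + l (s + 1) + 2 * s + 1)

variable (l v : ℕ → ℕ)

lemma Sfun_succ (s : ℕ) : Sfun l v (s + 1) = Sfun l v s + (v (s + 1) + l (s + 1)) := by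
  simp [Sfun, sum_Icc_succ_top]

lemma Sfun_nonneg (s : ℕ) : 0 ≤ Sfun l v s := sum_nonneg fun _ _ => by positivity

lemma exists_Sfun_eq (s : ℕ) : ∃ p : ℕ, Sfun l v s + 2 * s = p :=
  Int.eq_ofNat_of_zero_le (by have := Sfun_nonneg l v s; positivity)

lemma Afun_succ (k : ℕ) : Afun l v (k + 2) = Afun l v (k + 1) *
    zbinom (Sfun l v k + v (k + 1) + 2 * k) (Sfun l v k + l (k + 1) + 2 * k) := by
  simp [Afun, prod_range_succ]

variable {l v} in
lemma Sfun_congr {l' v' : ℕ → ℕ} {s : ℕ} (hl : ∀ m, 1 ≤ m → m ≤ s → l m = l' m)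
    (hv : ∀ m, 1 ≤ m → m ≤ s → v m = v' m) : Sfun l v s = Sfun l' v' s := by
  refine sum_congr rfl fun m hm => ?_
  rw [mem_Icc] at hm
  rw [hl m hm.1 hm.2, hv m hm.1 hm.2]

variable {l v} in
lemma Afun_congr {l' v' : ℕ → ℕ} {k : ℕ} (hl : ∀ m, 1 ≤ m → m < k → l m = l' m)
    (hv : ∀ m, 1 ≤ m → m < k → v m = v' m) : Afun l v k = Afun l' v' k := by
  refine prod_congr rfl fun s hs => ?_
  rw [mem_range] at hs
  rw [Sfun_congr (s := s) (fun m h₁ h₂ => hl m h₁ (by omega)) fun m h₁ h₂ => hv m h₁ (by omega),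
    hl (s + 1) (by omega) (by omega), hv (s + 1) (by omega) (by omega)]

lemma split_of_lt {j i m : ℕ} (h : m < j) : split l j i m = l m := by simp [split, h]

lemma split_self (j i : ℕ) : split l j i j = l j - i := by simp [split]

lemma split_succ (j i : ℕ) : split l j i (j + 1) = i - 1 := by simp [split]

lemma split_of_gt {j i m : ℕ} (h : j < m) : split l j i (m + 1) = l m := by
  simp [split, show ¬ m + 1 < j by omega, show m + 1 ≠ j by omega, show m ≠ j by omega]

lemma merge_of_lt {j m : ℕ} (h : m < j) : merge v j m = v m := by simp [merge, h]

lemma merge_self (j : ℕ) : merge v j j = v j + v (j + 1) + 1 := by simp [merge]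

lemma merge_of_gt {j m : ℕ} (h : j < m) : merge v j m = v (m + 1) := by
  simp [merge, show ¬ m < j by omega, show m ≠ j by omega]

variable {l} in
lemma Sfun_split {j i : ℕ} (hi : 1 ≤ i) (hil : i ≤ l (j + 1)) (x : ℕ) :
    Sfun (split l (j + 1) i) v (j + 2 + x) = Sfun l v (j + 1 + x) + v (j + 2 + x) - 1 := by
  induction x with
  | zero =>
    rw [add_zero, add_zero, Sfun_succ, Sfun_succ, Sfun_succ, split_self, split_succ,
      Sfun_congr (l' := l) (v' := v) (fun m _ h => split_of_lt l (by omega)) fun _ _ _ => rfl]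
    push_cast [hi, hil]
    ring
  | succ x ih =>
    rw [← add_assoc, Sfun_succ, ih, ← add_assoc (j + 1) x 1, Sfun_succ,
      split_of_gt l (show j + 1 < j + 2 + x by omega)]
    rw [show j + 1 + x + 1 = j + 2 + x by omega]
    ring

lemma Sfun_merge (j x : ℕ) :
    Sfun l (merge v (j + 1)) (j + 1 + x) = Sfun l v (j + 1 + x) + v (j + 2 + x) + 1 := by
  induction x with
  | zero =>
    rw [add_zero, add_zero, Sfun_succ, Sfun_succ, merge_self,
      Sfun_congr (l' := l) (v' := v) (fun _ _ _ => rfl) fun m _ h => merge_of_lt v (by omega)]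
    push_cast
    ring
  | succ x ih =>
    rw [← add_assoc, Sfun_succ, ih, Sfun_succ,
      merge_of_gt v (show j + 1 < j + 1 + x + 1 by omega)]
    rw [show j + 1 + x + 1 + 1 = j + 2 + (x + 1) by omega,
      show j + 1 + x + 1 = j + 2 + x by omega]
    ring

lemma Afun_split_last {n i : ℕ} (hil : i ≤ l (n + 1)) :
    Afun (split l (n + 1) i) v (n + 2) = Afun l v (n + 1) *
      zbinom (Sfun l v n + 2 * n + v (n + 1)) (Sfun l v n + 2 * n + l (n + 1) - i) := by
  rw [Afun_succ, split_self,
    Afun_congr (l' := l) (v' := v) (fun m _ h => split_of_lt l h) fun _ _ _ => rfl,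
    Sfun_congr (l' := l) (v' := v) (fun m _ h => split_of_lt l (by omega)) fun _ _ _ => rfl]
  push_cast [hil]
  congr 2 <;> ring

lemma Afun_split {n j i : ℕ} (hj : j < n) (hi : 1 ≤ i) (hil : i ≤ l (j + 1)) :
    Afun (split l (j + 1) i) v (n + 2) = Afun l v (j + 1) *
      (zbinom (Sfun l v j + 2 * j + v (j + 1)) (Sfun l v j + 2 * j + l (j + 1) - i) *
        zbinom (Sfun l v j + 2 * j + v (j + 1) + v (j + 2) + l (j + 1) - i + 2)
          (Sfun l v j + 2 * j + l (j + 1) + v (j + 1) + 1)) * tailProd l v n (j + 1) := by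
  obtain ⟨r, rfl⟩ : ∃ r, n = j + 1 + r := ⟨n - (j + 1), by omega⟩
  have h := Afun_succ (split l (j + 1) i) v (j + 1)
  rw [Afun_split_last l v hil, split_succ, Sfun_succ, split_self,
    Sfun_congr (l' := l) (v' := v) (fun m _ h => split_of_lt l (by omega)) fun _ _ _ => rfl] at h
  have h' : Afun (split l (j + 1) i) v (j + 1 + r + 2) =
      Afun (split l (j + 1) i) v (j + 1 + 2) * tailProd l v (j + 1 + r) (j + 1) := by
    rw [Afun, show j + 1 + r + 2 - 1 = j + 2 + r by omega, prod_range_add, tailProd,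
      prod_Ico_eq_prod_range]
    congr 1
    rw [show j + 1 + r - (j + 1) = r by omega]
    refine prod_congr rfl fun x _ => ?_
    rw [Sfun_split v hi hil, split_of_gt l (show j + 1 < j + 2 + x by omega)]
    rw [show j + 1 + x + 2 = j + 2 + x + 1 by omega, show j + 1 + x + 1 = j + 2 + x by omega]
    push_cast
    congr 1 <;> ring
  rw [h', h]
  push_cast [hi, hil]
  rw [mul_assoc (Afun l v (j + 1))]
  congr 4 <;> ring

lemma Afun_merge_last (n : ℕ) : Afun l (merge v (n + 1)) (n + 1) = Afun l v (n + 1) :=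
  Afun_congr (fun _ _ _ => rfl) fun _ _ h => merge_of_lt v h

lemma Afun_merge {n j : ℕ} (hj : j < n) :
    Afun l (merge v (j + 1)) (n + 1) = Afun l v (j + 1) *
      zbinom (Sfun l v j + 2 * j + v (j + 1) + v (j + 2) + 1) (Sfun l v j + 2 * j + l (j + 1)) *
        tailProd l v n (j + 1) := by
  obtain ⟨r, rfl⟩ : ∃ r, n = j + 1 + r := ⟨n - (j + 1), by omega⟩
  have h := Afun_succ l (merge v (j + 1)) j
  rw [Afun_merge_last, merge_self,
    Sfun_congr (l' := l) (v' := v) (fun _ _ _ => rfl) fun m _ h => merge_of_lt v (by omega)] at h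
  have h' : Afun l (merge v (j + 1)) (j + 1 + r + 1) =
      Afun l (merge v (j + 1)) (j + 2) * tailProd l v (j + 1 + r) (j + 1) := by
    rw [Afun, show j + 1 + r + 1 - 1 = j + 1 + r by omega, prod_range_add, tailProd,
      prod_Ico_eq_prod_range]
    congr 1
    rw [show j + 1 + r - (j + 1) = r by omega]
    refine prod_congr rfl fun x _ => ?_
    rw [Sfun_merge, merge_of_gt v (show j + 1 < j + 1 + x + 1 by omega)]
    rw [show j + 1 + x + 2 = j + 1 + x + 1 + 1 by omega, show j + 2 + x = j + 1 + x + 1 by omega]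
    push_cast
    congr 1 <;> ring
  rw [h', h]
  push_cast
  congr 3 <;> ring

lemma alternating_sum_add_succ (E : ℕ → ℤ) (n : ℕ) :
    ∑ j ∈ range n, (-1) ^ (n - j) * (E j + E (j + 1)) = (-1) ^ n * E 0 - E n := by
  induction n with
  | zero => simp
  | succ n ih =>
    have : ∑ j ∈ range n, (-1) ^ (n + 1 - j) * (E j + E (j + 1)) =
        -∑ j ∈ range n, (-1) ^ (n - j) * (E j + E (j + 1)) := by
      rw [← sum_neg_distrib]
      refine sum_congr rfl fun j hj => ?_
      rw [mem_range] at hj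
      rw [Nat.sub_add_comm hj.le, pow_succ]
      ring
    rw [sum_range_succ, this, ih, Nat.add_sub_cancel_left, pow_succ]
    ring

/-- The part of the chain map identity that does not involve the leftmost vertex weight. -/
lemma sum_split_eq_sum_merge (n : ℕ) :
    ∑ j ∈ range n, (-1) ^ (n - j) * ∑ i ∈ Icc 1 (l (j + 1)),
        zbinom ((l (j + 1) : ℤ) + 1) ((l (j + 1) : ℤ) - i + 1) *
          Afun (split l (j + 1) i) v (n + 2) =
      ∑ j ∈ range n, (-1) ^ (n - j) * (zbinom ((v (j + 1) : ℤ) + v (j + 2) + 2)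
          ((v (j + 1) : ℤ) + 1) * Afun l (merge v (j + 1)) (n + 1)) +
        Afun l v (n + 1) * zbinom (Sfun l v n + 2 * n + v (n + 1)) ((v (n + 1) : ℤ) + 1) := by
  let E : ℕ → ℤ := fun j => Afun l v (j + 1) *
    zbinom (Sfun l v j + 2 * j + v (j + 1)) ((v (j + 1) : ℤ) + 1) * tailProd l v n j
  have h₀ : E 0 = 0 := by
    simp only [E]
    rw [zbinom_eq_zero_of_lt] <;> simp [Sfun]
  have hn : E n = Afun l v (n + 1) *
      zbinom (Sfun l v n + 2 * n + v (n + 1)) ((v (n + 1) : ℤ) + 1) := by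
    simp [E, tailProd]
  have key : ∀ j ∈ range n, (-1) ^ (n - j) * ∑ i ∈ Icc 1 (l (j + 1)),
        zbinom ((l (j + 1) : ℤ) + 1) ((l (j + 1) : ℤ) - i + 1) *
          Afun (split l (j + 1) i) v (n + 2) =
      (-1) ^ (n - j) * (zbinom ((v (j + 1) : ℤ) + v (j + 2) + 2)
          ((v (j + 1) : ℤ) + 1) * Afun l (merge v (j + 1)) (n + 1)) -
        (-1) ^ (n - j) * (E j + E (j + 1)) := by
    intro j hj
    rw [mem_range] at hj
    rw [← mul_sub]
    congr 1
    have hE : E j = Afun l v (j + 1) *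
        (zbinom (Sfun l v j + 2 * j + v (j + 1)) ((v (j + 1) : ℤ) + 1) *
          zbinom (Sfun l v j + 2 * j + v (j + 1) + v (j + 2) + 1)
            (Sfun l v j + 2 * j + v (j + 1) + l (j + 1) + 1)) * tailProd l v n (j + 1) := by
      simp only [E]
      rw [tailProd, prod_eq_prod_Ico_succ_bot hj, ← tailProd, ← mul_assoc, mul_assoc (Afun _ _ _)]
      congr 4 <;> ring
    have hE' : E (j + 1) = Afun l v (j + 1) *
        (zbinom (Sfun l v j + 2 * j + v (j + 1)) (Sfun l v j + 2 * j + l (j + 1)) *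
          zbinom (Sfun l v j + 2 * j + l (j + 1) + v (j + 1) + v (j + 2) + 2)
            ((v (j + 2) : ℤ) + 1)) * tailProd l v n (j + 1) := by
      simp only [E]
      rw [Afun_succ, Sfun_succ, mul_assoc (Afun _ _ _)]
      push_cast
      congr 3
      · congr 1 <;> ring
      · congr 1; ring
    have hsum : ∑ i ∈ Icc 1 (l (j + 1)), zbinom ((l (j + 1) : ℤ) + 1) ((l (j + 1) : ℤ) - i + 1) *
          Afun (split l (j + 1) i) v (n + 2) =
        Afun l v (j + 1) * (∑ i ∈ Icc 1 (l (j + 1)),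
          zbinom ((l (j + 1) : ℤ) + 1) ((l (j + 1) : ℤ) - i + 1) *
          zbinom (Sfun l v j + 2 * j + v (j + 1)) (Sfun l v j + 2 * j + l (j + 1) - i) *
          zbinom (Sfun l v j + 2 * j + v (j + 1) + v (j + 2) + l (j + 1) - i + 2)
            (Sfun l v j + 2 * j + l (j + 1) + v (j + 1) + 1)) * tailProd l v n (j + 1) := by
      rw [mul_sum, sum_mul]
      refine sum_congr rfl fun i hi => ?_
      rw [mem_Icc] at hi
      rw [Afun_split l v hj hi.1 hi.2]
      ring
    obtain ⟨p, hp⟩ := exists_Sfun_eq l v j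
    rw [hsum, Afun_merge l v hj, hE, hE', hp]
    linear_combination Afun l v (j + 1) * tailProd l v n (j + 1) *
      sum_Icc_zbinom_mul_zbinom_mul_zbinom p (v (j + 1)) (v (j + 2)) (l (j + 1))
  rw [sum_congr rfl key, sum_sub_distrib, alternating_sum_add_succ, h₀, hn]
  ring

lemma Afun_eq_zero {n s : ℕ} (hs : s < n) (h : v (s + 1) < l (s + 1)) :
    Afun l v (n + 1) = 0 := by
  refine prod_eq_zero (i := s) (by simpa using hs) (zbinom_eq_zero_of_lt ?_ (by omega))
  have := Sfun_nonneg l v s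
  positivity

/-- The part of the chain map identity that involves the leftmost vertex weight. -/
lemma sum_split_last_eq_merge_last (n : ℕ) (x : ℤ)
    (h : ∑ m ∈ Icc 1 (n + 1), l m = ∑ m ∈ Icc 1 (n + 2), v m + 1) :
    ∑ i ∈ Icc 1 (l (n + 1)), zbinom (x + l (n + 1)) ((l (n + 1) : ℤ) - i + 1) *
          Afun (split l (n + 1) i) v (n + 2) +
        Afun l v (n + 1) * zbinom (Sfun l v n + 2 * n + v (n + 1)) ((v (n + 1) : ℤ) + 1) =
      zbinom (x + Sfun l v n + 2 * n + l (n + 1) + v (n + 1)) ((v (n + 1) : ℤ) + 1) *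
        Afun l (merge v (n + 1)) (n + 1) := by
  have hsum : ∑ i ∈ Icc 1 (l (n + 1)), zbinom (x + l (n + 1)) ((l (n + 1) : ℤ) - i + 1) *
          Afun (split l (n + 1) i) v (n + 2) =
      Afun l v (n + 1) * ∑ i ∈ Icc 1 (l (n + 1)),
        zbinom (x + l (n + 1)) ((l (n + 1) : ℤ) - i + 1) *
          zbinom (Sfun l v n + 2 * n + v (n + 1)) (Sfun l v n + 2 * n + l (n + 1) - i) := by
    rw [mul_sum]
    refine sum_congr rfl fun i hi => ?_
    rw [Afun_split_last l v (mem_Icc.mp hi).2]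
    ring
  rw [hsum, Afun_merge_last]
  by_cases hlv : ∀ s < n, l (s + 1) ≤ v (s + 1)
  · have hle : ∑ m ∈ Icc 1 n, l m ≤ ∑ m ∈ Icc 1 n, v m := by
      refine sum_le_sum fun m hm => ?_
      rw [mem_Icc] at hm
      obtain ⟨s, rfl⟩ := Nat.exists_eq_add_of_le' hm.1
      exact hlv s (by omega)
    rw [sum_Icc_succ_top (by omega), sum_Icc_succ_top (by omega),
      sum_Icc_succ_top (by omega)] at h
    obtain ⟨p, hp⟩ := exists_Sfun_eq l v n
    rw [add_assoc x, hp]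
    have key := sum_Icc_zbinom_mul_zbinom (x + l (n + 1)) p (v (n + 1)) (l (n + 1)) (by omega)
    rw [show x + p + l (n + 1) + v (n + 1) = x + l (n + 1) + p + v (n + 1) by ring, ← key]
    ring
  · push Not at hlv
    obtain ⟨s, hs, hlt⟩ := hlv
    rw [Afun_eq_zero l v hs hlt]
    ring

end Products

section Tuples

lemma toFun_succ {n : ℕ} (f : Fin n → ℕ) (i : Fin n) : toFun n f (i + 1) = f i := by
  simp [toFun]

lemma sum_toFun {n : ℕ} (f : Fin n → ℕ) : ∑ m ∈ Icc 1 n, toFun n f m = ∑ i, f i := by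
  have : ∑ m ∈ Icc 1 n, toFun n f m = ∑ k ∈ range n, toFun n f (k + 1) := by
    refine sum_nbij' (fun i => i - 1) (fun k => k + 1) ?_ ?_ ?_ ?_ ?_ <;> intro i hi <;>
      simp only [mem_Icc, mem_range] at hi ⊢ <;> try omega
    congr 1; omega
  rw [this, ← Fin.sum_univ_eq_sum_range]
  exact sum_congr rfl fun i _ => toFun_succ f i

lemma toFun_restrict {n : ℕ} (g : ℕ → ℕ) {m : ℕ} (h₁ : 1 ≤ m) (h₂ : m ≤ n) :
    toFun n (fun i => g (i + 1)) m = g m := by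
  simp [toFun, h₁, h₂]

/-- Summation over weak compositions against the indicator of a single composition. -/
lemma sum_antidiagonalTuple_ite {n k : ℕ} (g : ℕ → ℕ) (hg : ∑ m ∈ Icc 1 n, g m = k)
    (F : (ℕ → ℕ) → ℤ) (hF : ∀ f, (∀ m ∈ Icc 1 n, f m = g m) → F f = F g) :
    ∑ mu ∈ Finset.Nat.antidiagonalTuple n k,
      (if ∀ m ∈ Icc (1 : ℕ) n, toFun n mu m = g m then F (toFun n mu) else 0) = F g := by
  have hr : ∀ m ∈ Icc 1 n, toFun n (fun i => g (i + 1)) m = g m := fun m hm =>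
    toFun_restrict g (mem_Icc.mp hm).1 (mem_Icc.mp hm).2
  rw [sum_eq_single (fun i : Fin n => g (i + 1))]
  · rw [if_pos hr, hF _ hr]
  · intro mu _ hne
    refine if_neg fun h => hne (funext fun i => ?_)
    rw [← toFun_succ mu i]
    exact h _ (by rw [mem_Icc]; omega)
  · intro hmem
    refine absurd ?_ hmem
    rw [Finset.Nat.mem_antidiagonalTuple, ← sum_toFun, ← hg]
    exact sum_congr rfl hr

lemma sum_split {t j i : ℕ} (l : ℕ → ℕ) (hj : j ∈ Icc 1 t) (hi : i ∈ Icc 1 (l j)) :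
    ∑ m ∈ Icc 1 (t + 1), split l j i m + 1 = ∑ m ∈ Icc 1 t, l m := by
  rw [mem_Icc] at hj hi
  obtain ⟨j, rfl⟩ := Nat.exists_eq_add_of_le' hj.1
  obtain ⟨r, rfl⟩ := Nat.exists_eq_add_of_le hj.2
  clear hj
  induction r with
  | zero =>
    rw [add_zero, sum_Icc_succ_top (by omega), sum_Icc_succ_top (by omega), split_succ, split_self,
      sum_Icc_succ_top (by omega), sum_congr rfl fun m hm => split_of_lt l (j := j + 1) (i := i) ?_]
    · omega
    · rw [mem_Icc] at hm; omega
  | succ r ih =>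
    rw [sum_Icc_succ_top (by omega), ← add_assoc, sum_Icc_succ_top (b := j + 1 + r) (by omega) l,
      ← ih, split_of_gt l (by omega)]
    ring

lemma split_eq_iff {t j i : ℕ} (l v : ℕ → ℕ) (hj : j ∈ Icc 1 t) (hi : i ∈ Icc 1 (l j)) :
    (∀ m ∈ Icc 1 (t + 1), v m = split l j i m) ↔
      i = v (j + 1) + 1 ∧ ∀ m ∈ Icc 1 t, l m = merge v j m := by
  simp only [mem_Icc] at *
  constructor
  · intro h
    have h₁ := h j (by omega)
    have h₂ := h (j + 1) (by omega)
    rw [split_self] at h₁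
    rw [split_succ] at h₂
    refine ⟨by omega, fun m hm => ?_⟩
    rcases lt_trichotomy m j with hmj | rfl | hmj
    · rw [merge_of_lt v hmj, h m (by omega), split_of_lt l hmj]
    · rw [merge_self]; omega
    · rw [merge_of_gt v hmj, h (m + 1) (by omega), split_of_gt l hmj]
  · rintro ⟨rfl, h⟩ m hm
    have h₁ := h j (by omega)
    rw [merge_self] at h₁
    rcases lt_trichotomy m j with hmj | rfl | hmj
    · rw [split_of_lt l hmj, h m (by omega), merge_of_lt v hmj]
    · rw [split_self]; omega
    · obtain ⟨m, rfl⟩ := Nat.exists_eq_add_of_le' hm.1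
      rcases (show j ≤ m by omega).eq_or_lt with rfl | hmj'
      · rw [split_succ]; omega
      · rw [split_of_gt l hmj', h m (by omega), merge_of_gt v hmj']

lemma sum_merge {t j : ℕ} (v : ℕ → ℕ) (hj : j ∈ Icc 1 t) :
    ∑ m ∈ Icc 1 t, merge v j m = ∑ m ∈ Icc 1 (t + 1), v m + 1 := by
  have hi : v (j + 1) + 1 ∈ Icc 1 (merge v j j) := by
    rw [merge_self, mem_Icc]; omega
  rw [← sum_split (merge v j) hj hi]
  congr 1
  exact (sum_congr rfl ((split_eq_iff (merge v j) v hj hi).mpr ⟨rfl, fun _ _ => rfl⟩)).symm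

end Tuples

section ChainMap

/-- The binomial coefficient attached by the differential to splitting `l j` at its `i`-th edge. -/
noncomputable def splitCoeff (x : ℤ) (t : ℕ) (l : ℕ → ℕ) (j i : ℕ) : ℤ :=
  (-1 : ℤ) ^ (t - j) *
    (if j = t then zbinom (x + (l t : ℤ)) ((l t : ℤ) - i + 1)
      else zbinom ((l j : ℤ) + 1) ((l j : ℤ) - i + 1))

lemma Dmat_eq (x : ℤ) (t : ℕ) (v l : ℕ → ℕ) : Dmat x t v l =
    ∑ j ∈ Icc 1 t, ∑ i ∈ Icc 1 (l j),
      if ∀ m ∈ Icc (1 : ℕ) (t + (1 : ℕ)), v m = split l j i m then splitCoeff x t l j i else 0 := rfl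

lemma Amat_congr {d t : ℕ} (ht : 1 ≤ t) {l l' v v' : ℕ → ℕ} (hl : ∀ m ∈ Icc 1 t, l m = l' m)
    (hv : ∀ m ∈ Icc 1 t, v m = v' m) : Amat d t l v = Amat d t l' v' := by
  simp only [mem_Icc] at hl hv
  rw [Amat, Amat, hv t ⟨ht, le_rfl⟩,
    Afun_congr (fun m h₁ h₂ => hl m ⟨h₁, h₂.le⟩) fun m h₁ h₂ => hv m ⟨h₁, h₂.le⟩]

lemma sum_Amat_mul_Dmat (d t : ℕ) (x : ℤ) (l v : ℕ → ℕ) (k : ℕ)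
    (hl : ∑ m ∈ Icc 1 t, l m = k + 1) :
    ∑ mu ∈ Finset.Nat.antidiagonalTuple (t + 1) k,
        Amat d (t + 1) (toFun (t + 1) mu) v * Dmat x t (toFun (t + 1) mu) l =
      ∑ j ∈ Icc 1 t, ∑ i ∈ Icc 1 (l j),
        Amat d (t + 1) (split l j i) v * splitCoeff x t l j i := by
  simp only [Dmat_eq, mul_sum, mul_ite, mul_zero]
  rw [sum_comm]
  refine sum_congr rfl fun j hj => ?_
  rw [sum_comm]
  refine sum_congr rfl fun i hi => ?_
  refine sum_antidiagonalTuple_ite (split l j i) ?_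
    (fun f => Amat d (t + 1) f v * splitCoeff x t l j i) ?_
  · have := sum_split l hj hi
    omega
  · intro f hf
    rw [Amat_congr (by omega) hf fun _ _ => rfl]

lemma sum_Dmat_mul_Amat (d t : ℕ) (y : ℤ) (l v : ℕ → ℕ) (k : ℕ)
    (hv : ∑ m ∈ Icc 1 (t + 1), v m + 1 = k) :
    ∑ mu ∈ Finset.Nat.antidiagonalTuple t k,
        Dmat y t v (toFun t mu) * Amat d t l (toFun t mu) =
      ∑ j ∈ Icc 1 t,
        splitCoeff y t (merge v j) j (v (j + 1) + 1) * Amat d t l (merge v j) := by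
  simp only [Dmat_eq, sum_mul]
  rw [sum_comm]
  refine sum_congr rfl fun j hj => ?_
  refine Eq.trans (sum_congr rfl fun mu _ => ?_) (sum_antidiagonalTuple_ite (merge v j) ?_
    (fun f => splitCoeff y t f j (v (j + 1) + 1) * Amat d t l f) ?_)
  · have hj' := mem_Icc.mp hj
    by_cases h : ∀ m ∈ Icc 1 t, toFun t mu m = merge v j m
    · have hi : v (j + 1) + 1 ∈ Icc 1 (toFun t mu j) := by
        rw [h j hj, merge_self, mem_Icc]; omega
      rw [if_pos h, sum_eq_single_of_mem _ hi, if_pos ((split_eq_iff _ v hj hi).mpr ⟨rfl, h⟩)]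
      intro i hi' hne
      rw [if_neg fun h' => hne ((split_eq_iff _ v hj hi').mp h').1, zero_mul]
    · rw [if_neg h]
      refine sum_eq_zero fun i hi => ?_
      rw [if_neg fun h' => h ((split_eq_iff _ v hj hi).mp h').2, zero_mul]
  · rw [sum_merge v hj, hv]
  · intro f hf
    have hj' := mem_Icc.mp hj
    rw [Amat_congr (by omega) (fun _ _ => rfl) hf, splitCoeff, splitCoeff, hf j hj,
      hf t (by rw [mem_Icc]; omega)]

lemma sum_split_mul_splitCoeff (d n : ℕ) (x : ℤ) (l v : ℕ → ℕ)
    (hd : ∑ m ∈ Icc 1 (n + 1), l m + n = d)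
    (h : ∑ m ∈ Icc 1 (n + 1), l m = ∑ m ∈ Icc 1 (n + 2), v m + 1) :
    ∑ j ∈ Icc 1 (n + 1), ∑ i ∈ Icc 1 (l j),
        Amat d (n + 2) (split l j i) v * splitCoeff x (n + 1) l j i =
      ∑ j ∈ Icc 1 (n + 1), splitCoeff (-x - 2 * d) (n + 1) (merge v j) j (v (j + 1) + 1) *
        Amat d (n + 1) l (merge v j) := by
  have hL : ∀ j ∈ range n, ∑ i ∈ Icc 1 (l (j + 1)),
      Amat d (n + 2) (split l (j + 1) i) v * splitCoeff x (n + 1) l (j + 1) i =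
      (-1) ^ (d - v (n + 2)) * ((-1) ^ (n - j) * ∑ i ∈ Icc 1 (l (j + 1)),
        zbinom ((l (j + 1) : ℤ) + 1) ((l (j + 1) : ℤ) - i + 1) *
          Afun (split l (j + 1) i) v (n + 2)) := by
    intro j hj
    rw [mem_range] at hj
    simp only [mul_sum]
    refine sum_congr rfl fun i _ => ?_
    rw [Amat, splitCoeff, if_neg (by omega), Nat.add_sub_add_right]
    ring
  have hR : ∀ j ∈ range n,
      splitCoeff (-x - 2 * d) (n + 1) (merge v (j + 1)) (j + 1) (v (j + 1 + 1) + 1) *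
        Amat d (n + 1) l (merge v (j + 1)) =
      (-1) ^ (d - v (n + 2)) * ((-1) ^ (n - j) * (zbinom ((v (j + 1) : ℤ) + v (j + 2) + 2)
          ((v (j + 1) : ℤ) + 1) * Afun l (merge v (j + 1)) (n + 1))) := by
    intro j hj
    rw [mem_range] at hj
    rw [Amat, splitCoeff, if_neg (by omega), Nat.add_sub_add_right, merge_self,
      merge_of_gt v (show j + 1 < n + 1 by omega)]
    push_cast
    rw [show (v (j + 1) : ℤ) + v (j + 1 + 1) + 1 - (v (j + 1 + 1) + 1) + 1 = v (j + 1) + 1 by ring,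
      show (v (j + 1) : ℤ) + v (j + 1 + 1) + 1 + 1 = v (j + 1) + v (j + 2) + 2 by ring]
    ring
  have hL' : ∑ i ∈ Icc 1 (l (n + 1)),
      Amat d (n + 2) (split l (n + 1) i) v * splitCoeff x (n + 1) l (n + 1) i =
      (-1) ^ (d - v (n + 2)) * ∑ i ∈ Icc 1 (l (n + 1)),
        zbinom (x + l (n + 1)) ((l (n + 1) : ℤ) - i + 1) *
          Afun (split l (n + 1) i) v (n + 2) := by
    rw [mul_sum]
    refine sum_congr rfl fun i _ => ?_
    rw [Amat, splitCoeff, if_pos rfl, Nat.sub_self]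
    ring
  have hS : Sfun l v n + l (n + 1) + v (n + 1) + v (n + 2) + 2 * n + 1 = 2 * d := by
    have h₁ : Sfun l v (n + 2) = ∑ m ∈ Icc 1 (n + 2), (v m : ℤ) +
        ∑ m ∈ Icc 1 (n + 1), (l m : ℤ) + l (n + 2) := by
      rw [Sfun, sum_add_distrib, add_assoc,
        sum_Icc_succ_top (b := n + 1) (by omega) (fun m => (l m : ℤ))]
    rw [Sfun_succ, Sfun_succ] at h₁
    zify at hd h
    linarith
  have hR' : splitCoeff (-x - 2 * d) (n + 1) (merge v (n + 1)) (n + 1) (v (n + 1 + 1) + 1) *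
        Amat d (n + 1) l (merge v (n + 1)) =
      (-1) ^ (d - v (n + 1 + 1)) * (zbinom (x + Sfun l v n + 2 * n + l (n + 1) + v (n + 1))
        ((v (n + 1) : ℤ) + 1) * Afun l (merge v (n + 1)) (n + 1)) := by
    have hle : v (n + 1) + v (n + 1 + 1) + 1 ≤ d := by
      rw [sum_Icc_succ_top (b := n + 1) (by omega) v, sum_Icc_succ_top (b := n) (by omega) v] at h
      omega
    rw [Amat, splitCoeff, if_pos rfl, Nat.sub_self, merge_self]
    push_cast
    rw [show (v (n + 1) : ℤ) + v (n + 1 + 1) + 1 - (v (n + 1 + 1) + 1) + 1 =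
        ((v (n + 1) + 1 : ℕ) : ℤ) by push_cast; ring,
      show -x - 2 * d + (v (n + 1) + v (n + 1 + 1) + 1) =
        -(x + 2 * d - v (n + 1) - v (n + 2) - 1) by ring, zbinom_neg]
    rw [show x + 2 * d - v (n + 1) - v (n + 2) - 1 + ((v (n + 1) + 1 : ℕ) : ℤ) - 1 =
      x + Sfun l v n + 2 * n + l (n + 1) + v (n + 1) by push_cast; linarith,
      show d - v (n + 1 + 1) = d - (v (n + 1) + v (n + 1 + 1) + 1) + (v (n + 1) + 1) by omega, pow_add]
    push_cast
    ring
  rw [sum_Icc_one_eq_sum_range_succ, sum_Icc_one_eq_sum_range_succ, sum_range_succ, sum_range_succ,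
    sum_congr rfl hL, sum_congr rfl hR, hL', hR', ← mul_sum, ← mul_sum,
    sum_split_eq_sum_merge, ← sum_split_last_eq_merge_last l v n x h]
  ring

end ChainMap

section Invertible

lemma Afun_self (l : ℕ → ℕ) (k : ℕ) : Afun l l k = 1 := by
  refine prod_eq_one fun s _ => zbinom_self ?_
  have := Sfun_nonneg l l s
  positivity

lemma isUnit_of_Amat (d n k : ℕ) :
    IsUnit (Matrix.of
      (fun lam mu : {a // a ∈ Finset.Nat.antidiagonalTuple (n + 1) k} =>
        Amat d (n + 1) (toFun (n + 1) lam.1) (toFun (n + 1) mu.1))) := by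
  let b : {a // a ∈ Finset.Nat.antidiagonalTuple (n + 1) k} → Lex (Fin n → ℕ) :=
    fun a => toLex fun i => a.1 i.castSucc
  have hb : Function.Injective b := by
    rintro ⟨f, hf⟩ ⟨g, hg⟩ h
    rw [Finset.Nat.mem_antidiagonalTuple, Fin.sum_univ_castSucc] at hf hg
    have hinit : ∀ i : Fin n, f i.castSucc = g i.castSucc := fun i =>
      congrFun (toLex.injective h) i
    refine Subtype.ext (funext fun i => ?_)
    refine Fin.lastCases ?_ hinit i
    rw [sum_congr rfl fun i _ => hinit i] at hf
    change f (Fin.last n) = g (Fin.last n)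
    omega
  let : LinearOrder {a // a ∈ Finset.Nat.antidiagonalTuple (n + 1) k} := LinearOrder.lift' b hb
  rw [Matrix.isUnit_iff_isUnit_det, Matrix.det_of_isUpperTriangular]
  · refine IsUnit.prod_iff.mpr fun a _ => ?_
    rw [Matrix.of_apply, Amat, Afun_self, mul_one]
    exact (isUnit_neg_one).pow _
  · intro f g hlt
    rw [Matrix.of_apply, Amat]
    have hnot : ¬ ∀ i : Fin n, f.1 i.castSucc ≤ g.1 i.castSucc := fun h =>
      absurd (Pi.toLex_monotone h : b f ≤ b g) (not_le.mpr hlt)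
    push Not at hnot
    obtain ⟨i, hi⟩ := hnot
    rw [Afun_eq_zero _ _ i.2, mul_zero]
    have := toFun_succ f.1 i.castSucc
    have := toFun_succ g.1 i.castSucc
    simp_all

end Invertible

/-- Theorem 1.1 (main theorem): for every `d ≥ 1` the arithmetic complexes `C_•(x, 1^d)`
and `C_•(-x-2d, 1^d)` are isomorphic via the chain map `α_•` with coefficients
`α(λ,μ) = (-1)^{d-μ_t} ∏_{s=0}^{t-2} binom(∑_{j≤s}(λ_j+μ_j)+μ_{s+1}+2s,
∑_{j≤s}(λ_j+μ_j)+λ_{s+1}+2s)`: `α_•` commutes with the differentials (for every integer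
value of `x`, equivalently over the ring of integer-valued polynomials), and in each
homological degree the matrix of `α` is invertible over `ℤ`. -/
theorem stmt15 (d : ℕ) (hd : 1 ≤ d) :
    (∀ x : ℤ, ∀ t : ℕ, 1 ≤ t → t ≤ d →
      ∀ lam : Fin t → ℕ, ∑ i, lam i = d + 1 - t →
      ∀ nu : Fin (t + 1) → ℕ, ∑ i, nu i = d - t →
      ∑ mu ∈ Finset.Nat.antidiagonalTuple (t + 1) (d - t),
          Amat d (t + 1) (toFun (t + 1) mu) (toFun (t + 1) nu) *
            Dmat x t (toFun (t + 1) mu) (toFun t lam) =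
        ∑ mu ∈ Finset.Nat.antidiagonalTuple t (d + 1 - t),
          Dmat (-x - 2 * d) t (toFun (t + 1) nu) (toFun t mu) *
            Amat d t (toFun t lam) (toFun t mu)) ∧
    (∀ t : ℕ, 1 ≤ t → t ≤ d + 1 →
      IsUnit (Matrix.of
        (fun lam mu : {a // a ∈ Finset.Nat.antidiagonalTuple t (d + 1 - t)} =>
          Amat d t (toFun t lam.1) (toFun t mu.1)))) := by
  refine ⟨fun x t ht htd lam hlam nu hnu => ?_, fun t ht _ => ?_⟩
  · obtain ⟨n, rfl⟩ := Nat.exists_eq_add_of_le' ht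
    rw [← sum_toFun] at hlam hnu
    rw [sum_Amat_mul_Dmat d (n + 1) x _ _ _ (by omega),
      sum_Dmat_mul_Amat d (n + 1) _ _ _ _ (by omega)]
    exact sum_split_mul_splitCoeff d n x _ _ (by omega)
      (by rw [hlam]; change _ = ∑ m ∈ Icc 1 (n + 1 + 1), _ + 1; omega)
  · obtain ⟨n, rfl⟩ := Nat.exists_eq_add_of_le' ht
    exact isUnit_of_Amat d n _
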